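/- Let c and q be positive integers and let 𝔠 be an ample q-zigzagged (2c+3q, 2c·C(c+q−1, c))-constellation (where C(c+q−1,c) is the binomial coefficient). Then there are anticomplete subsets X, Y of V(𝔠) such that the subgraphs induced on X and on Y each have treewidth at least c. -/

import Mathlib

open SimpleGraph

/-- Two vertex sets `X` and `Y` are *anticomplete* in `G` if they are disjoint and
there is no edge of `G` with an end in each. -/
def Anticomplete {V : Type} (G : SimpleGraph V) (X Y : Set V) : Prop :=
  Disjoint X Y ∧ ∀ x ∈ X, ∀ y ∈ Y, ¬ G.Adj x y

/-- `G` has an induced subgraph isomorphic to `H`. -/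
def HasInducedSubgraphIso {V W : Type} (G : SimpleGraph V) (H : SimpleGraph W) : Prop :=
  ∃ X : Set V, Nonempty (H ≃g G.induce X)

/-- `G` has an induced minor isomorphic to `H`, witnessed by branch sets. -/
def HasInducedMinor {V W : Type} (G : SimpleGraph V) (H : SimpleGraph W) : Prop :=
  ∃ B : W → Set V,
    (∀ w, (G.induce (B w)).Connected) ∧
    (Pairwise fun u v => Disjoint (B u) (B v)) ∧
    (∀ u v : W, u ≠ v → (H.Adj u v ↔ ¬ Anticomplete G (B u) (B v)))

/-- The set `P` induces a path in `G`. -/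
def IsPathSet {V : Type} (G : SimpleGraph V) (P : Set V) : Prop :=
  ∃ n : ℕ, Nonempty (G.induce P ≃g pathGraph (n + 1))

/-- The vertex sets of the connected components of the subgraph of `G` induced on `X`. -/
def CompsOn {V : Type} (G : SimpleGraph V) (X : Set V) : Set (Set V) :=
  {L | ∃ C : (G.induce X).ConnectedComponent, L = Subtype.val '' C.supp}

/-- The induced subgraph of `G` on `W` together with the stable set `S ⊆ W` forms a
constellation: every component of `W \ S` is a path and every vertex of `S` has a
neighbor in every such component. -/
structure IsConstellationOn {V : Type} (G : SimpleGraph V) (W S : Set V) : Prop where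
  subset : S ⊆ W
  stable : ∀ x ∈ S, ∀ y ∈ S, ¬ G.Adj x y
  comp_paths : ∀ L ∈ CompsOn G (W \ S), IsPathSet G L
  dominates : ∀ x ∈ S, ∀ L ∈ CompsOn G (W \ S), ∃ y ∈ L, G.Adj x y

/-- `p` is a route of the constellation `(W, S)` in `G`: an induced path of the induced
subgraph of `G` on `W`, with its two (distinct) ends in `S` and its interior outside `S`. -/
structure IsRoute {V : Type} (G : SimpleGraph V) (W S : Set V) {x y : V}
    (p : G.Walk x y) : Prop where
  ne : x ≠ y
  isPath : p.IsPath
  induced : ∀ u v, u ∈ p.support → v ∈ p.support → G.Adj u v → p.toSubgraph.Adj u v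
  support_mem : ∀ v ∈ p.support, v ∈ W
  fst_mem : x ∈ S
  snd_mem : y ∈ S
  interior : ∀ v ∈ p.support, v ≠ x → v ≠ y → v ∉ S

/-- The constellation `(W, S)` in `G` is `d`-ample: no route has length at most `d+1`. -/
def DAmple {V : Type} (G : SimpleGraph V) (W S : Set V) (d : ℕ) : Prop :=
  ∀ ⦃x y : V⦄ (p : G.Walk x y), IsRoute G W S p → d + 1 < p.length

/-- The constellation `(W, S)` in `G` is interrupted with respect to some linear order
(encoded by an injective-on-`S` function `f : V → ℕ`). -/
def Interrupted {V : Type} (G : SimpleGraph V) (W S : Set V) : Prop :=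
  ∃ f : V → ℕ, Set.InjOn f S ∧
    ∀ x ∈ S, ∀ y ∈ S, ∀ z ∈ S, f x < f y → f y < f z →
      ∀ (p : G.Walk x y), IsRoute G W S p → ∃ v ∈ p.support, G.Adj z v

/-- The constellation `(W, S)` in `G` is `q`-zigzagged. -/
def Zigzagged {V : Type} (G : SimpleGraph V) (W S : Set V) (q : ℕ) : Prop :=
  ∃ f : V → ℕ, Set.InjOn f S ∧
    ∀ x ∈ S, ∀ y ∈ S, f x < f y →
      ∀ (p : G.Walk x y), IsRoute G W S p →
        {z | z ∈ S ∧ f x < f z ∧ f z < f y ∧ ¬ ∃ v ∈ p.support, G.Adj z v}.ncard < q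

/-- The constellation `(W, S)` in `G` is `(qm, q, qp)`-mixed. -/
def Mixed {V : Type} (G : SimpleGraph V) (W S : Set V) (qm q qp : ℕ) : Prop :=
  ∃ f : V → ℕ, Set.InjOn f S ∧
    ∀ x ∈ S, ∀ y ∈ S, f x < f y →
      ∀ (p : G.Walk x y), IsRoute G W S p →
        ∀ Qm Q Qp : Set V, Qm ⊆ S → Q ⊆ S → Qp ⊆ S →
          Qm.ncard = qm → Q.ncard = q → Qp.ncard = qp →
          (∀ z ∈ Qm, f z < f x) → (∀ z ∈ Q, f x < f z ∧ f z < f y) →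
          (∀ z ∈ Qp, f y < f z) →
          ∃ z ∈ Qm ∪ Q ∪ Qp, ∃ v ∈ p.support, G.Adj z v

/-- The constellation `(W', S')` sits in the constellation `(W, S)` (both within `G`). -/
def SitsIn {V : Type} (G : SimpleGraph V) (W' S' W S : Set V) : Prop :=
  W' ⊆ W ∧ S' ⊆ S ∧
  (∀ L ∈ CompsOn G (W' \ S'), ∃ M ∈ CompsOn G (W \ S), L ⊆ M) ∧
  (∀ M ∈ CompsOn G (W \ S), ∀ L₁ ∈ CompsOn G (W' \ S'), ∀ L₂ ∈ CompsOn G (W' \ S'),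
      L₁ ⊆ M → L₂ ⊆ M → L₁ = L₂)

/-- A witness that `S` is a subdivision of `H`, where each edge of `H` is replaced by a
path whose length satisfies `ok`. -/
structure SubdivModel {U W : Type} (S : SimpleGraph U) (H : SimpleGraph W)
    (ok : ℕ → Prop) where
  b : W → U
  b_inj : Function.Injective b
  path : ∀ ⦃u v : W⦄, H.Adj u v → S.Walk (b u) (b v)
  path_isPath : ∀ ⦃u v : W⦄ (h : H.Adj u v), (path h).IsPath
  path_len : ∀ ⦃u v : W⦄ (h : H.Adj u v), ok (path h).length
  path_symm : ∀ ⦃u v : W⦄ (h : H.Adj u v), path h.symm = (path h).reverse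
  branch_avoid : ∀ ⦃u v : W⦄ (h : H.Adj u v) (w : W), b w ∈ (path h).support → w = u ∨ w = v
  interiors_anticomplete :
    ∀ ⦃u v u' v' : W⦄ (h : H.Adj u v) (h' : H.Adj u' v'),
      (s(u, v) : Sym2 W) ≠ s(u', v') →
      ∀ x ∈ (path h).support, x ≠ b u → x ≠ b v →
      ∀ y ∈ (path h').support, y ≠ b u' → y ≠ b v' →
        x ≠ y ∧ ¬ S.Adj x y
  cover : ∀ x : U, (∃ w, x = b w) ∨ ∃ (u v : W) (h : H.Adj u v), x ∈ (path h).support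
  edges_eq : ∀ x y : U, S.Adj x y → ∃ (u v : W) (h : H.Adj u v), (path h).toSubgraph.Adj x y

/-- `S` is a subdivision of `H` with path lengths satisfying `ok`. -/
def IsSubdivisionWith {U W : Type} (S : SimpleGraph U) (H : SimpleGraph W)
    (ok : ℕ → Prop) : Prop :=
  Nonempty (SubdivModel S H ok)

/-- The line graph of `G`. -/
def LineGraph {V : Type} (G : SimpleGraph V) : SimpleGraph G.edgeSet :=
  SimpleGraph.fromRel (fun e f => ∃ v : V, v ∈ (e : Sym2 V) ∧ v ∈ (f : Sym2 V))

/-- The `r`-by-`r` hexagonal wall (brick wall). -/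
def Wall (r : ℕ) : SimpleGraph (Fin r × Fin (2 * r)) :=
  SimpleGraph.fromRel (fun a b =>
    (a.1 = b.1 ∧ a.2.val + 1 = b.2.val) ∨
    (a.2 = b.2 ∧ a.1.val + 1 = b.1.val ∧ (a.1.val + a.2.val) % 2 = 0))

/-- The full binary tree of radius `r`, on `2^(r+1) - 1` vertices (heap indexing). -/
def BinTree (r : ℕ) : SimpleGraph (Fin (2 ^ (r + 1) - 1)) :=
  SimpleGraph.fromRel (fun a b =>
    b.val + 1 = 2 * (a.val + 1) ∨ b.val + 1 = 2 * (a.val + 1) + 1)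

/-- The leaf-extension of `H` by leaves `L` attached via `f`. -/
def leafExt {W : Type} (H : SimpleGraph W) (L : Type) (f : L → W) :
    SimpleGraph (W ⊕ L) :=
  SimpleGraph.fromRel (fun a b =>
    match a, b with
    | Sum.inl a, Sum.inl b => H.Adj a b
    | Sum.inl a, Sum.inr x => f x = a
    | _, _ => False)

/-- `G` has treewidth at most `k` (via tree decompositions). -/
def TreewidthLE {V : Type} (G : SimpleGraph V) (k : ℕ) : Prop :=
  ∃ (ι : Type) (T : SimpleGraph ι) (bag : ι → Set V),
    T.IsTree ∧
    (∀ v, ∃ i, v ∈ bag i) ∧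
    (∀ u v, G.Adj u v → ∃ i, u ∈ bag i ∧ v ∈ bag i) ∧
    (∀ v, (T.induce {i | v ∈ bag i}).Connected) ∧
    (∀ i, (bag i).ncard ≤ k + 1)

/-- `G` has pathwidth at most `k` (via path decompositions). -/
def PathwidthLE {V : Type} (G : SimpleGraph V) (k : ℕ) : Prop :=
  ∃ (n : ℕ) (bag : Fin n → Set V),
    (∀ v, ∃ i, v ∈ bag i) ∧
    (∀ u v, G.Adj u v → ∃ i, u ∈ bag i ∧ v ∈ bag i) ∧
    (∀ (v : V) (i j k' : Fin n), i ≤ j → j ≤ k' → v ∈ bag i → v ∈ bag k' → v ∈ bag j) ∧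
    (∀ i, (bag i).ncard ≤ k + 1)

/-- An induced `(s,t)`-model in `G`. -/
def IsInducedModel {V : Type} (G : SimpleGraph V) {s t : ℕ}
    (A : Fin s → Set V) (B : Fin t → Set V) : Prop :=
  (∀ i, (G.induce (A i)).Connected) ∧
  (∀ j, (G.induce (B j)).Connected) ∧
  (∀ i j : Fin s, i ≠ j → Anticomplete G (A i) (A j)) ∧
  (∀ i j : Fin t, i ≠ j → Anticomplete G (B i) (B j)) ∧
  (∀ (i : Fin s) (j : Fin t), Disjoint (A i) (B j) ∧ ¬ Anticomplete G (A i) (B j))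

/-- The `A`-contraction of a model: each `A i` is contracted to the vertex `Sum.inl i`. -/
def AContraction {V : Type} (G : SimpleGraph V) {s t : ℕ}
    (A : Fin s → Set V) (B : Fin t → Set V) :
    SimpleGraph (Fin s ⊕ (⋃ j, B j : Set V)) :=
  SimpleGraph.fromRel (fun x y =>
    match x, y with
    | Sum.inl i, Sum.inl i' => i ≠ i' ∧ ∃ a ∈ A i, ∃ a' ∈ A i', G.Adj a a'
    | Sum.inl i, Sum.inr b => ∃ a ∈ A i, G.Adj a ↑b
    | Sum.inr b, Sum.inr b' => G.Adj ↑b ↑b'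
    | _, _ => False)

/-- A linear induced model is `d`-`A`-ample if its `A`-contraction is `d`-ample. -/
def ModelAAmple {V : Type} (G : SimpleGraph V) {s t : ℕ}
    (A : Fin s → Set V) (B : Fin t → Set V) (d : ℕ) : Prop :=
  DAmple (AContraction G A B) Set.univ (Set.range Sum.inl) d

/-- A linear induced model is `d`-ample if it is `d`-`A`-ample and `d`-`B`-ample. -/
def ModelAmple {V : Type} (G : SimpleGraph V) {s t : ℕ}
    (A : Fin s → Set V) (B : Fin t → Set V) (d : ℕ) : Prop :=
  ModelAAmple G A B d ∧ ModelAAmple G B A d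

/-- The zigzag sequences. -/
def Zseq : ℕ → List ℤ
  | 0 => []
  | 1 => [1]
  | 2 => [1, 2]
  | 3 => [1, 2, 3]
  | n + 4 =>
      (Zseq (n + 3)).dropLast ++ (((Zseq (n + 2)).map (· + 1)).reverse).dropLast
        ++ (Zseq (n + 3)).map (· + 1)

/-- Collapse each maximal run of consecutive equal entries to a single entry. -/
def collapse (l : List ℤ) : List ℤ := l.destutter (· ≠ ·)

/-- `B` is an alignment in the sequence `A`. -/
def IsAlignment (A : List ℤ) (B : Finset ℤ) : Prop :=
  (∀ b ∈ B, b ∈ A) ∧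
  ∃ i j : ℕ, i ≤ j ∧ j < A.length ∧
    ∀ b ∈ B,
      (collapse (((A.take (j + 1)).drop i).filter (fun a => decide (a ∈ B)))).count b = 1

/-- A walk of an induced subgraph, seen as a walk of the whole graph. -/
lemma exists_walk_of_induce_reachable {V : Type} {G : SimpleGraph V} {s : Set V} {u v : s}
    (h : (G.induce s).Reachable u v) : ∃ p : G.Walk u v, ∀ x ∈ p.support, x ∈ s := by
  obtain ⟨p⟩ := h
  induction p with
  | @nil u => exact ⟨.nil, by simp⟩
  | @cons u _ _ h p ih =>
    obtain ⟨q, hq⟩ := ih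
    exact ⟨.cons (induce_adj.1 h) q, by simpa using hq⟩

/-- A connected vertex set `C` of a tree rooted at `r` has a top vertex `t`: every path from `C`
to the root passes through `t`, and does not leave `C` before that. -/
lemma exists_top_of_induce_connected {ι : Type} {T : SimpleGraph ι} (hT : T.IsTree) (r : ι)
    {C : Set ι} (hC : (T.induce C).Connected) :
    ∃ t ∈ C, ∀ s ∈ C, ∀ p : T.Walk s r, p.IsPath →
      t ∈ p.support ∧ ∀ v ∈ p.support, T.dist t r ≤ T.dist v r → v ∈ C := by
  classical
  obtain ⟨x₀⟩ := hC.nonempty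
  obtain ⟨t, ht, hmin⟩ : ∃ t ∈ C, ∀ v ∈ C, T.dist t r ≤ T.dist v r := by
    have : Nonempty C := ⟨x₀⟩
    exact ⟨(Function.argmin (fun v : C => T.dist v.1 r)).1, Subtype.prop _,
      fun v hv => Function.argmin_le (fun v : C => T.dist v.1 r) ⟨v, hv⟩⟩
  refine ⟨t, ht, fun s hs p hp => ?_⟩
  obtain ⟨w, hw, hwC⟩ : ∃ w : T.Walk s t, w.IsPath ∧ ∀ v ∈ w.support, v ∈ C := by
    obtain ⟨w, hw⟩ := exists_walk_of_induce_reachable (hC.preconnected ⟨s, hs⟩ ⟨t, ht⟩)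
    exact ⟨w.bypass, w.bypass_isPath, fun v hv => hw v (w.support_bypass_subset_support hv)⟩
  obtain ⟨q, hq, hql⟩ := hT.connected.exists_path_of_dist t r
  have hqlt : ∀ v ∈ q.support, v ≠ t → T.dist v r < T.dist t r := by
    intro v hv hne
    rw [← hql]
    exact (dist_le _).trans_lt (Walk.length_dropUntil_lt_length hv hne)
  have hpath : (w.append q).IsPath := by
    rw [Walk.isPath_def, Walk.support_append]
    refine List.Nodup.append hw.support_nodup (hq.support_nodup.sublist (List.tail_sublist _)) ?_
    intro v hvw hvq
    have hne : v ≠ t := by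
      rintro rfl
      have := hq.support_nodup
      rw [← Walk.cons_tail_support] at this
      exact (List.nodup_cons.1 this).1 hvq
    exact absurd (hmin v (hwC v hvw)) (not_le.2 (hqlt v (List.mem_of_mem_tail hvq) hne))
  obtain rfl : p = w.append q := (hT.existsUnique_path s r).unique hp hpath
  refine ⟨by simp [Walk.mem_support_append_iff], fun v hv hle => ?_⟩
  rcases (Walk.mem_support_append_iff _ _).1 hv with h | h
  · exact hwC v h
  · by_cases hvt : v = t
    · exact hvt ▸ ht
    · exact absurd hle (not_le.2 (hqlt v h hvt))

/-- The Helly property for subtrees of a tree. -/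
lemma exists_mem_of_pairwise_inter {ι κ : Type} [Finite κ] [Nonempty κ] {T : SimpleGraph ι}
    (hT : T.IsTree) (C : κ → Set ι) (hC : ∀ k, (T.induce (C k)).Connected)
    (hmeet : ∀ k l, (C k ∩ C l).Nonempty) : ∃ t, ∀ k, t ∈ C k := by
  obtain ⟨r⟩ := hT.connected.nonempty
  choose t ht htop using fun k => exists_top_of_induce_connected hT r (hC k)
  obtain ⟨k, hk⟩ := Finite.exists_max (fun k => T.dist (t k) r)
  refine ⟨t k, fun l => ?_⟩
  obtain ⟨s, hsk, hsl⟩ := hmeet k l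
  obtain ⟨p, hp, -⟩ := hT.existsUnique_path s r
  exact (htop l s hsl p hp).2 _ (htop k s hsk p hp).1 (hk l)

/-- In a tree decomposition, the bags meeting a connected vertex set form a subtree. -/
lemma induce_bags_connected {ι V : Type} {G : SimpleGraph V} {T : SimpleGraph ι}
    {bag : ι → Set V} (hcov : ∀ v, ∃ i, v ∈ bag i)
    (hedge : ∀ u v, G.Adj u v → ∃ i, u ∈ bag i ∧ v ∈ bag i)
    (hconn : ∀ v, (T.induce {i | v ∈ bag i}).Connected)
    {B : Set V} (hB : (G.induce B).Connected) :
    (T.induce {i | ∃ v ∈ B, v ∈ bag i}).Connected := by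
  have key : ∀ v ∈ B, ∀ i j (hi : i ∈ {i | ∃ v ∈ B, v ∈ bag i})
      (hj : j ∈ {i | ∃ v ∈ B, v ∈ bag i}), v ∈ bag i → v ∈ bag j →
      (T.induce {i | ∃ v ∈ B, v ∈ bag i}).Reachable ⟨i, hi⟩ ⟨j, hj⟩ := by
    intro v hv i j hi hj hvi hvj
    exact ((hconn v).preconnected ⟨i, hvi⟩ ⟨j, hvj⟩).map
      (induceHomOfLE T (s := {i | v ∈ bag i}) (s' := {i | ∃ v ∈ B, v ∈ bag i})
        fun k hk => ⟨v, hv, hk⟩).toHom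
  have walk : ∀ (u v : B), (G.induce B).Walk u v →
      ∀ i j (hi : i ∈ {i | ∃ v ∈ B, v ∈ bag i})
      (hj : j ∈ {i | ∃ v ∈ B, v ∈ bag i}), u.1 ∈ bag i → v.1 ∈ bag j →
      (T.induce {i | ∃ v ∈ B, v ∈ bag i}).Reachable ⟨i, hi⟩ ⟨j, hj⟩ := by
    intro u v p
    induction p with
    | nil => exact fun i j hi hj => key _ (Subtype.prop _) i j hi hj
    | cons h p ih =>
      intro i j hi hj hui hvj
      obtain ⟨k, hk₁, hk₂⟩ := hedge _ _ (induce_adj.1 h)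
      exact (key _ (Subtype.prop _) i k hi ⟨_, Subtype.prop _, hk₁⟩ hui hk₁).trans
        (ih k j ⟨_, Subtype.prop _, hk₁⟩ hj hk₂ hvj)
  obtain ⟨b⟩ := hB.nonempty
  obtain ⟨i, hi⟩ := hcov b
  have : Nonempty {i | ∃ v ∈ B, v ∈ bag i} := ⟨⟨i, b.1, b.2, hi⟩⟩
  refine Connected.mk fun ⟨i, u, hu, hui⟩ ⟨j, v, hv, hvj⟩ => ?_
  obtain ⟨p⟩ := hB.preconnected ⟨u, hu⟩ ⟨v, hv⟩
  exact walk _ _ p i j _ _ hui hvj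

/-- A graph with a complete minor on `k + 2` vertices has treewidth greater than `k`. -/
lemma not_treewidthLE_of_branch_sets {V κ : Type} [Finite V] [Fintype κ] [Nonempty κ]
    {G : SimpleGraph V} {k : ℕ}
    (hk : k + 1 < Fintype.card κ) (B : κ → Set V) (hconn : ∀ i, (G.induce (B i)).Connected)
    (hdisj : Pairwise fun i j => Disjoint (B i) (B j))
    (hadj : Pairwise fun i j => ∃ x ∈ B i, ∃ y ∈ B j, G.Adj x y) : ¬ TreewidthLE G k := by
  rintro ⟨ι, T, bag, hT, hcov, hedge, hbag, hcard⟩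
  obtain ⟨t, ht⟩ := exists_mem_of_pairwise_inter hT (fun i => {t | ∃ v ∈ B i, v ∈ bag t})
    (fun i => induce_bags_connected hcov hedge hbag (hconn i)) (by
      intro i j
      by_cases hij : i = j
      · subst hij
        obtain ⟨b⟩ := (hconn i).nonempty
        obtain ⟨t, ht⟩ := hcov b
        exact ⟨t, ⟨b, b.2, ht⟩, ⟨b, b.2, ht⟩⟩
      · obtain ⟨x, hx, y, hy, hxy⟩ := hadj hij
        obtain ⟨t, h₁, h₂⟩ := hedge x y hxy
        exact ⟨t, ⟨x, hx, h₁⟩, ⟨y, hy, h₂⟩⟩)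
  choose g hgB hgt using ht
  have hinj : Function.Injective g := by
    intro i j hij
    by_contra hne
    exact Set.disjoint_left.1 (hdisj hne) (hgB i) (hij ▸ hgB j)
  have : Fintype.card κ ≤ (bag t).ncard := by
    rw [← Nat.card_eq_fintype_card, ← Set.ncard_univ, ← Set.ncard_image_of_injective _ hinj]
    exact Set.ncard_le_ncard (by rintro _ ⟨i, -, rfl⟩; exact hgt i) (Set.toFinite _)
  have := hcard t
  omega

/-- Restricting to a superset `X` does not affect connectivity of induced subgraphs. -/
lemma induce_preimage_connected {V : Type} {G : SimpleGraph V} {X B : Set V} (hBX : B ⊆ X)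
    (hB : (G.induce B).Connected) :
    ((G.induce X).induce (Subtype.val ⁻¹' B)).Connected := by
  refine (Iso.connected_iff (⟨⟨fun b => ⟨⟨b.1, hBX b.2⟩, b.2⟩, fun b => ⟨b.1.1, b.2⟩,
    fun _ => rfl, fun _ => rfl⟩, Iff.rfl⟩ : G.induce B ≃g _)).1 hB

/-- Contracting pairwise disjoint connected sets `P j`, each with neighbors in all of `c`
further vertices, yields a `K_{c,c}` minor and hence treewidth at least `c`. -/
lemma not_treewidthLE_of_bipartite_minor {V : Type} [Finite V] {G : SimpleGraph V} {c : ℕ}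
    (hc : 0 < c) (X : Set V) (a : Fin c → V) (P : Fin c → Set V) (ha : Function.Injective a)
    (haX : ∀ i, a i ∈ X) (hPX : ∀ i, P i ⊆ X) (haP : ∀ i j, a i ∉ P j)
    (hconn : ∀ i, (G.induce (P i)).Connected)
    (hdisj : Pairwise fun i j => Disjoint (P i) (P j))
    (hadj : ∀ i j, ∃ y ∈ P j, G.Adj (a i) y) : ¬ TreewidthLE (G.induce X) (c - 1) := by
  classical
  let o : Fin c := ⟨0, hc⟩
  let B : Option (Fin c) → Set V := fun k =>
    k.elim {a o} (fun i => if i = o then P i else {a i} ∪ P i)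
  have hPB : ∀ i, P i ⊆ B (some i) := by
    intro i
    by_cases h : i = o <;> simp [B, h]
  have haB : ∀ i, i ≠ o → a i ∈ B (some i) := by
    intro i h
    simp [B, h]
  have hBsub : ∀ i, ∀ x ∈ B (some i), x ∈ P i ∨ (x = a i ∧ i ≠ o) := by
    intro i x hx
    by_cases h : i = o <;> simp [B, h] at hx ⊢ <;> tauto
  have hBX : ∀ k, B k ⊆ X := by
    rintro (_ | i) x hx
    · rw [show x = a o from hx]
      exact haX o
    · rcases hBsub i x hx with h | ⟨rfl, -⟩
      · exact hPX i h
      · exact haX i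
  have hBconn : ∀ k, (G.induce (B k)).Connected := by
    rintro (_ | i)
    · have : Nonempty ({a o} : Set V) := ⟨⟨a o, rfl⟩⟩
      exact (Connected.mk Preconnected.of_subsingleton : (G.induce {a o}).Connected)
    · by_cases h : i = o
      · rw [show B (some i) = P i from if_pos h]
        exact hconn i
      · obtain ⟨y, hy, hay⟩ := hadj i i
        rw [show B (some i) = {a i} ∪ P i from if_neg h]
        exact connected_induce_union Preconnected.of_subsingleton
          (hconn i).preconnected rfl hy hay
  have hBdisj : ∀ k l, k ≠ l → Disjoint (B k) (B l) := by
    have hnone : ∀ i, a o ∉ B (some i) := fun i hx => by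
      rcases hBsub i _ hx with h | ⟨h, hne⟩
      · exact haP o i h
      · exact hne (ha h).symm
    rintro (_ | i) (_ | j) hne
    · exact absurd rfl hne
    · exact Set.disjoint_singleton_left.2 (hnone j)
    · exact Set.disjoint_singleton_right.2 (hnone i)
    · have hij : i ≠ j := fun h => hne (by rw [h])
      refine Set.disjoint_left.2 fun x hx hy => ?_
      rcases hBsub i x hx with h₁ | ⟨h₁, -⟩ <;> rcases hBsub j x hy with h₂ | ⟨h₂, -⟩
      · exact Set.disjoint_left.1 (hdisj hij) h₁ h₂
      · exact haP j i (h₂ ▸ h₁)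
      · exact haP i j (h₁ ▸ h₂)
      · exact hij (ha (h₁.symm.trans h₂))
  have hBadj : ∀ k l, k ≠ l → ∃ x ∈ B k, ∃ y ∈ B l, G.Adj x y := by
    have hnone : ∀ j, ∃ x ∈ B none, ∃ y ∈ B (some j), G.Adj x y := fun j => by
      obtain ⟨y, hy, hay⟩ := hadj o j
      exact ⟨a o, rfl, y, hPB j hy, hay⟩
    rintro (_ | i) (_ | j) hne
    · exact absurd rfl hne
    · exact hnone j
    · obtain ⟨x, hx, y, hy, hxy⟩ := hnone i
      exact ⟨y, hy, x, hx, hxy.symm⟩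
    · by_cases hi : i = o
      · have hj : j ≠ o := fun h => hne (by rw [hi, h])
        obtain ⟨y, hy, hay⟩ := hadj j i
        exact ⟨y, hPB i hy, a j, haB j hj, hay.symm⟩
      · obtain ⟨y, hy, hay⟩ := hadj i j
        exact ⟨a i, haB i hi, y, hPB j hy, hay⟩
  refine not_treewidthLE_of_branch_sets (κ := Option (Fin c)) ?_ (fun k => Subtype.val ⁻¹' B k)
    (fun k => induce_preimage_connected (hBX k) (hBconn k))
    (fun k l hkl => (hBdisj k l hkl).preimage _) (fun k l hkl => ?_)
  · simp only [Fintype.card_option, Fintype.card_fin]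
    omega
  · obtain ⟨x, hx, y, hy, hxy⟩ := hBadj k l hkl
    exact ⟨⟨x, hBX k hx⟩, hx, ⟨y, hBX l hy⟩, hy, hxy⟩

lemma eq_of_mem_compsOn {V : Type} {G : SimpleGraph V} {X L L' : Set V} (hL : L ∈ CompsOn G X)
    (hL' : L' ∈ CompsOn G X) {u v : V} (hu : u ∈ L) (hv : v ∈ L') (huv : u = v ∨ G.Adj u v) :
    L = L' := by
  obtain ⟨C, rfl⟩ := hL
  obtain ⟨C', rfl⟩ := hL'
  obtain ⟨u, hu, rfl⟩ := hu
  obtain ⟨v, hv, rfl⟩ := hv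
  have hreach : (G.induce X).Reachable u v := by
    rcases huv with h | h
    · rw [Subtype.ext h]
    · exact Adj.reachable (induce_adj.2 h)
  rw [ConnectedComponent.mem_supp_iff] at hu hv
  rw [← hu, ← hv, ConnectedComponent.sound hreach]

lemma subset_of_mem_compsOn {V : Type} {G : SimpleGraph V} {X L : Set V} (hL : L ∈ CompsOn G X) :
    L ⊆ X := by
  obtain ⟨C, rfl⟩ := hL
  rintro _ ⟨v, -, rfl⟩
  exact v.2

/-- A shortest walk within `W` from `x` to a vertex of `B`. -/
lemma exists_shortest_walk {V : Type} {G : SimpleGraph V} {W B : Set V} {x : V}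
    (h : ∃ y ∈ B, ∃ p : G.Walk x y, ∀ v ∈ p.support, v ∈ W) :
    ∃ y ∈ B, ∃ p : G.Walk x y, p.IsPath ∧ (∀ v ∈ p.support, v ∈ W) ∧
      ∀ y' ∈ B, ∀ p' : G.Walk x y', (∀ v ∈ p'.support, v ∈ W) → p.length ≤ p'.length := by
  classical
  have h' : ∃ n, ∃ y ∈ B, ∃ p : G.Walk x y, (∀ v ∈ p.support, v ∈ W) ∧ p.length = n := by
    obtain ⟨y, hy, p, hp⟩ := h
    exact ⟨_, y, hy, p, hp, rfl⟩
  obtain ⟨y, hy, p, hp, hpl⟩ := Nat.find_spec h'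
  refine ⟨y, hy, p.bypass, p.bypass_isPath,
    fun v hv => hp v (p.support_bypass_subset_support hv), fun y' hy' p' hp' => ?_⟩
  exact p.length_bypass_le_length.trans
    (hpl ▸ Nat.find_min' h' ⟨y', hy', p', hp', rfl⟩)

lemma mem_support_of_mem_support_take {V : Type} {G : SimpleGraph V} {x y v : V}
    {p : G.Walk x y} {n : ℕ} (hv : v ∈ (p.take n).support) : v ∈ p.support := by
  rw [Walk.support_take] at hv
  exact List.mem_of_mem_take hv

lemma mem_support_of_mem_support_drop {V : Type} {G : SimpleGraph V} {x y v : V}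
    {p : G.Walk x y} {n : ℕ} (hv : v ∈ (p.drop n).support) : v ∈ p.support := by
  obtain ⟨k, rfl, -⟩ := Walk.mem_support_iff_exists_getVert.1 hv
  rw [Walk.drop_getVert]
  exact p.getVert_mem_support _

/-- The inner vertices of a walk other than the last one induce a connected subgraph. -/
lemma exists_connected_truncated_interior {V : Type} {G : SimpleGraph V} {x y : V}
    (p : G.Walk x y) (hp : 3 ≤ p.length) :
    (G.induce {v | ∃ k, 0 < k ∧ k + 1 < p.length ∧ v = p.getVert k}).Connected := by
  suffices h : {v | ∃ k, 0 < k ∧ k + 1 < p.length ∧ v = p.getVert k} =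
      {v | v ∈ ((p.drop 1).take (p.length - 3)).support} from
    h ▸ Walk.connected_induce_support _
  ext v
  simp only [Set.mem_ofPred_eq, Walk.mem_support_iff_exists_getVert, Walk.take_getVert,
    Walk.drop_getVert, Walk.take_length, Walk.drop_length]
  constructor
  · rintro ⟨k, h₀, h₁, rfl⟩
    exact ⟨k - 1, by congr 1; omega, by omega⟩
  · rintro ⟨k, rfl, hk⟩
    exact ⟨1 + min (p.length - 3) k, by omega, by omega, rfl⟩

/-- In an ample constellation, no vertex outside `S` has two neighbors in `S`. -/
lemma DAmple.eq_of_adj {V : Type} {G : SimpleGraph V} {S : Set V}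
    (hstable : ∀ x ∈ S, ∀ y ∈ S, ¬ G.Adj x y) (ha : DAmple G Set.univ S 1) {x y w : V}
    (hx : x ∈ S) (hy : y ∈ S) (hxw : G.Adj x w) (hyw : G.Adj y w) : x = y := by
  by_contra hne
  have hw : w ∉ S := fun hw => hstable x hx w hw hxw
  have := ha (.cons hxw (.cons hyw.symm .nil)) {
    ne := hne
    isPath := by simp [Walk.cons_isPath_iff, hne, hxw.ne, hyw.ne.symm]
    induced := by
      intro u v hu hv huv
      have h₁ := hstable x hx y hy
      have h₂ := hstable y hy x hx
      simp only [Walk.support_cons, Walk.support_nil, List.mem_cons, List.not_mem_nil,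
        or_false] at hu hv
      rcases hu with rfl | rfl | rfl <;> rcases hv with rfl | rfl | rfl <;>
        simp_all [Walk.toSubgraph, SimpleGraph.adj_comm]
    support_mem := fun _ _ => trivial
    fst_mem := hx
    snd_mem := hy
    interior := by
      intro v hv h₁ h₂
      simp only [Walk.support_cons, Walk.support_nil, List.mem_cons, List.not_mem_nil,
        or_false] at hv
      rcases hv with rfl | rfl | rfl <;> tauto }
  simp at this

/-- A component `L` of a constellation contains a connected set which has no neighbors in `B`,
but contains a neighbor of every vertex `z ∈ S \ B` which has a neighbor on a certain route
from `x` to `B`. -/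
lemma exists_route_truncation {V : Type} {G : SimpleGraph V} {S : Set V}
    (hc : IsConstellationOn G Set.univ S) (ha : DAmple G Set.univ S 1)
    {L : Set V} (hL : L ∈ CompsOn G (Set.univ \ S)) {x : V} (hx : x ∈ S) {B : Set V}
    (hBS : B ⊆ S) (hB : B.Nonempty) (hxB : x ∉ B) :
    ∃ P ⊆ L, (G.induce P).Connected ∧ (∀ b ∈ B, ∀ v ∈ P, ¬ G.Adj b v) ∧
      (∃ v ∈ P, G.Adj x v) ∧
      ∃ y ∈ B, ∃ p : G.Walk x y, IsRoute G Set.univ S p ∧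
        ∀ z ∈ S, z ∉ B → (∃ v ∈ p.support, G.Adj z v) → ∃ v ∈ P, G.Adj z v := by
  have hLS : ∀ v ∈ L, v ∉ S := fun v hv => (subset_of_mem_compsOn hL hv).2
  have hex : ∃ y ∈ B, ∃ p : G.Walk x y, ∀ v ∈ p.support, v ∈ insert x (L ∪ B) := by
    obtain ⟨y, hy⟩ := hB
    obtain ⟨u, hu, hxu⟩ := hc.dominates x hx L hL
    obtain ⟨w, hw, hyw⟩ := hc.dominates y (hBS hy) L hL
    obtain ⟨q, hq⟩ : ∃ q : G.Walk u w, ∀ v ∈ q.support, v ∈ L := by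
      obtain ⟨n, ⟨e⟩⟩ := hc.comp_paths L hL
      have : (G.induce L).Connected := e.connected_iff.2 (pathGraph_connected n)
      exact exists_walk_of_induce_reachable (this.preconnected ⟨u, hu⟩ ⟨w, hw⟩)
    refine ⟨y, hy, .cons hxu (q.concat hyw.symm), fun v hv => ?_⟩
    simp only [Walk.support_cons, Walk.support_concat, List.mem_cons, List.mem_append,
      List.not_mem_nil, or_false] at hv
    rcases hv with rfl | hv | rfl
    · exact Or.inl rfl
    · exact Or.inr (Or.inl (hq v hv))
    · exact Or.inr (Or.inr hy)
  obtain ⟨y, hy, p, hpath, hpW, hmin⟩ := exists_shortest_walk hex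
  have hxy : x ≠ y := fun h => hxB (h ▸ hy)
  have hinner : ∀ k, 0 < k → k < p.length → p.getVert k ∈ L := by
    intro k h₀ h₁
    rcases hpW _ (p.getVert_mem_support k) with h | h | h
    · have := hmin y hy ((p.drop k).copy h rfl) (fun v hv => by
        rw [Walk.support_copy] at hv
        exact hpW v (mem_support_of_mem_support_drop hv))
      rw [Walk.length_copy, Walk.drop_length] at this
      omega
    · exact h
    · have := hmin _ h (p.take k) (fun v hv =>
        hpW v (mem_support_of_mem_support_take hv))
      rw [Walk.take_length] at this
      omega
  have hchord : ∀ i j, i < j → j ≤ p.length → G.Adj (p.getVert i) (p.getVert j) →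
      j = i + 1 := by
    intro i j hij hj hadj
    have := hmin y hy ((p.take i).append (.cons hadj (p.drop j))) (fun v hv => by
      rw [Walk.mem_support_append_iff, Walk.support_cons, List.mem_cons] at hv
      rcases hv with hv | rfl | hv
      · exact hpW v (mem_support_of_mem_support_take hv)
      · exact hpW _ (p.getVert_mem_support i)
      · exact hpW v (mem_support_of_mem_support_drop hv))
    rw [Walk.length_append, Walk.length_cons, Walk.take_length, Walk.drop_length] at this
    omega
  have hroute : IsRoute G Set.univ S p := {
    ne := hxy
    isPath := hpath
    induced := by
      intro u v hu hv huv
      obtain ⟨i, rfl, hi⟩ := Walk.mem_support_iff_exists_getVert.1 hu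
      obtain ⟨j, rfl, hj⟩ := Walk.mem_support_iff_exists_getVert.1 hv
      rcases lt_trichotomy i j with h | h | h
      · obtain rfl := hchord i j h hj huv
        exact p.toSubgraph_adj_getVert hj
      · subst h
        exact absurd rfl huv.ne
      · obtain rfl := hchord j i h hi huv.symm
        exact (p.toSubgraph_adj_getVert hi).symm
    support_mem := fun _ _ => trivial
    fst_mem := hx
    snd_mem := hBS hy
    interior := by
      intro v hv h₁ h₂
      obtain ⟨k, rfl, hk⟩ := Walk.mem_support_iff_exists_getVert.1 hv
      refine hLS _ (hinner k (Nat.pos_of_ne_zero ?_) (lt_of_le_of_ne hk ?_))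
      · rintro rfl
        exact h₁ p.getVert_zero
      · rintro rfl
        exact h₂ p.getVert_length }
  have hlen : 3 ≤ p.length := ha p hroute
  have hlast : G.Adj y (p.getVert (p.length - 1)) := by
    have := p.adj_getVert_succ (i := p.length - 1) (by omega)
    rw [Nat.sub_add_cancel (by omega), p.getVert_length] at this
    exact this.symm
  refine ⟨_, ?_, exists_connected_truncated_interior p hlen, ?_, ?_, y, hy, p, hroute, ?_⟩
  · rintro _ ⟨k, h₀, h₁, rfl⟩
    exact hinner k h₀ (by omega)
  · rintro b hb _ ⟨k, h₀, h₁, rfl⟩ hadj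
    have := hmin b hb ((p.take k).concat hadj.symm) (fun v hv => by
      rw [Walk.support_concat, List.mem_append, List.mem_singleton] at hv
      rcases hv with hv | rfl
      · exact hpW v (mem_support_of_mem_support_take hv)
      · exact Or.inr (Or.inr hb))
    rw [Walk.length_concat, Walk.take_length] at this
    omega
  · refine ⟨p.getVert 1, ⟨1, by omega, by omega, rfl⟩, ?_⟩
    simpa using p.adj_getVert_succ (i := 0) (by omega)
  · rintro z hz hzB ⟨v, hv, hzv⟩
    obtain ⟨k, rfl, hk⟩ := Walk.mem_support_iff_exists_getVert.1 hv
    refine ⟨_, ⟨k, Nat.pos_of_ne_zero ?_, ?_, rfl⟩, hzv⟩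
    · rintro rfl
      rw [p.getVert_zero] at hzv
      exact hc.stable z hz x hx hzv
    · have h₁ : k ≠ p.length := by
        rintro rfl
        rw [p.getVert_length] at hzv
        exact hc.stable z hz y (hBS hy) hzv
      have h₂ : k ≠ p.length - 1 := by
        rintro rfl
        exact hzB (ha.eq_of_adj hc.stable hz (hBS hy) hzv hlast ▸ hy)
      omega

lemma IsRoute.reverse {V : Type} {G : SimpleGraph V} {W S : Set V} {x y : V} {p : G.Walk x y}
    (hp : IsRoute G W S p) : IsRoute G W S p.reverse where
  ne := hp.ne.symm
  isPath := hp.isPath.reverse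
  induced := by
    intro u v hu hv huv
    rw [Walk.toSubgraph_reverse]
    exact hp.induced u v (by simpa using hu) (by simpa using hv) huv
  support_mem := fun v hv => hp.support_mem v (by simpa using hv)
  fst_mem := hp.snd_mem
  snd_mem := hp.fst_mem
  interior := fun v hv h₁ h₂ => hp.interior v (by simpa using hv) h₂ h₁

/-- If few vertices of `A` are missed by routes from `x ∈ A` to `B`, then among sufficiently many
components there are `c` with connected subsets that have no neighbors in `B`, but have neighbors
in common `c` vertices of `A`. -/
lemma exists_bipartite_model {V : Type} [Finite V] {G : SimpleGraph V} {S : Set V} {c q : ℕ}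
    (hc : IsConstellationOn G Set.univ S) (ha : DAmple G Set.univ S 1)
    (A B : Finset V) (hAS : ∀ z ∈ A, z ∈ S) (hBS : ∀ z ∈ B, z ∈ S) (hAB : Disjoint A B)
    (hB : B.Nonempty) (hq : 0 < q) (hA : A.card = c + q - 1) {x : V} (hx : x ∈ A)
    (hmiss : ∀ y ∈ B, ∀ p : G.Walk x y, IsRoute G Set.univ S p →
      {z | z ∈ A ∧ z ≠ x ∧ ¬ ∃ v ∈ p.support, G.Adj z v}.ncard < q)
    (𝓛 : Finset (Set V)) (h𝓛 : ∀ L ∈ 𝓛, L ∈ CompsOn G (Set.univ \ S))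
    (hcard : (c + q - 1).choose c * c ≤ 𝓛.card) :
    ∃ (a : Fin c → V) (L P : Fin c → Set V), Function.Injective a ∧ Function.Injective L ∧
      (∀ i, a i ∈ A) ∧ (∀ j, L j ∈ 𝓛) ∧ (∀ j, P j ⊆ L j) ∧ (∀ j, (G.induce (P j)).Connected) ∧
      (∀ i j, ∃ v ∈ P j, G.Adj (a i) v) ∧ ∀ b ∈ B, ∀ j, ∀ v ∈ P j, ¬ G.Adj b v := by
  classical
  have hpiece : ∀ L ∈ 𝓛, ∃ P ⊆ L, (G.induce P).Connected ∧ (∀ b ∈ B, ∀ v ∈ P, ¬ G.Adj b v) ∧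
      ∃ A' ∈ A.powersetCard c, ∀ z ∈ A', ∃ v ∈ P, G.Adj z v := by
    intro L hL
    obtain ⟨P, hPL, hP, hPB, hxP, y, hy, p, hp, hPz⟩ := exists_route_truncation hc ha (h𝓛 L hL)
      (hAS x hx) (B := B) hBS hB (Finset.disjoint_left.1 hAB hx)
    refine ⟨P, hPL, hP, hPB, ?_⟩
    have hm := hmiss y hy p hp
    have h₁ : (A.filter fun z => ¬ ∃ v ∈ P, G.Adj z v).card < q := by
      rw [← Set.ncard_coe_finset]
      refine (Set.ncard_le_ncard ?_ (Set.toFinite _)).trans_lt hm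
      intro z hz
      obtain ⟨hzA, hz⟩ := Finset.mem_filter.1 hz
      exact ⟨hzA, fun h => hz (h ▸ hxP),
        fun h => hz (hPz z (hAS z hzA) (Finset.disjoint_left.1 hAB hzA) h)⟩
    have h₂ := Finset.card_filter_add_card_filter_not (s := A) (fun z => ∃ v ∈ P, G.Adj z v)
    obtain ⟨A', hA', hcA⟩ := Finset.exists_subset_card_eq
      (show c ≤ (A.filter fun z => ∃ v ∈ P, G.Adj z v).card by omega)
    exact ⟨A', Finset.mem_powersetCard.2 ⟨hA'.trans (Finset.filter_subset _ _), hcA⟩,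
      fun z hz => (Finset.mem_filter.1 (hA' hz)).2⟩
  choose! P hPL hP hPB A' hA' hPA using hpiece
  have hne : (A.powersetCard c).Nonempty := Finset.powersetCard_nonempty.2 (by omega)
  obtain ⟨C, hC, hfib⟩ := Finset.exists_le_card_fiber_of_mul_le_card_of_maps_to hA' hne
    (n := c) (by rwa [Finset.card_powersetCard, hA])
  obtain ⟨F, hF, hFc⟩ := Finset.exists_subset_card_eq hfib
  have hF' : ∀ L ∈ F, L ∈ 𝓛 ∧ A' L = C := fun L hL => Finset.mem_filter.1 (hF hL)
  obtain ⟨hCA, hCc⟩ := Finset.mem_powersetCard.1 hC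
  let e := (C.equivFinOfCardEq hCc).symm
  let e' := (F.equivFinOfCardEq hFc).symm
  refine ⟨fun i => e i, fun j => e' j, fun j => P (e' j),
    Subtype.val_injective.comp e.injective, Subtype.val_injective.comp e'.injective,
    fun i => hCA (e i).2, fun j => (hF' _ (e' j).2).1, fun j => hPL _ (hF' _ (e' j).2).1,
    fun j => hP _ (hF' _ (e' j).2).1, fun i j => ?_,
    fun b hb j => hPB _ (hF' _ (e' j).2).1 b hb⟩
  obtain ⟨h₁, h₂⟩ := hF' _ (e' j).2
  exact hPA _ h₁ _ (h₂ ▸ (e i).2)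

/-- The `k` smallest elements of a finite set, together with their minimum. -/
lemma exists_initial_segment {V α : Type} [LinearOrder α] (f : V → α) (s : Finset V)
    (hf : Set.InjOn f s) {k : ℕ} (hk : 0 < k) (hks : k ≤ s.card) :
    ∃ A ⊆ s, A.card = k ∧ (∀ a ∈ A, ∀ b ∈ s, b ∉ A → f a < f b) ∧
      ∃ x ∈ A, ∀ z ∈ A, z ≠ x → f x < f z := by
  classical
  have hseg : ∀ k ≤ s.card, ∃ A ⊆ s, A.card = k ∧ ∀ a ∈ A, ∀ b ∈ s, b ∉ A → f a < f b := by
    intro k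
    induction k with
    | zero => exact fun _ => ⟨∅, by simp⟩
    | succ k ih =>
      intro hk
      obtain ⟨A, hAs, hA, hlt⟩ := ih (by omega)
      obtain ⟨m, hm, hmin⟩ := (s \ A).exists_min_image f
        (Finset.card_pos.1 (by rw [Finset.card_sdiff_of_subset hAs]; omega))
      obtain ⟨hms, hmA⟩ := Finset.mem_sdiff.1 hm
      refine ⟨insert m A, Finset.insert_subset hms hAs, by
        rw [Finset.card_insert_of_notMem hmA, hA], fun a ha b hb hbA => ?_⟩
      rw [Finset.mem_insert, not_or] at hbA
      rcases Finset.mem_insert.1 ha with rfl | ha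
      · exact lt_of_le_of_ne (hmin b (Finset.mem_sdiff.2 ⟨hb, hbA.2⟩))
          fun h => hbA.1 (hf hb hms h.symm)
      · exact hlt a ha b hb hbA.2
  obtain ⟨A, hAs, hA, hlt⟩ := hseg k hks
  obtain ⟨x, hx, hmin⟩ := A.exists_min_image f (Finset.card_pos.1 (by omega))
  exact ⟨A, hAs, hA, hlt, x, hx, fun z hz hne => lt_of_le_of_ne (hmin z hz)
    fun h => hne (hf (hAs hz) (hAs hx) h.symm)⟩

/-- Lemma 8.3: an ample `q`-zigzagged
`(2c+3q, 2c·C(c+q−1,c))`-constellation contains two anticomplete vertex subsets each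
inducing a subgraph of treewidth at least `c`. -/
theorem stmt16 {V : Type} [Fintype V] (c q : ℕ) (hcpos : 0 < c) (hq : 0 < q)
    (G : SimpleGraph V) (S : Set V)
    (hc : IsConstellationOn G Set.univ S)
    (ha : DAmple G Set.univ S 1)
    (hz : Zigzagged G Set.univ S q)
    (hS : S.ncard = 2 * c + 3 * q)
    (hL : (CompsOn G (Set.univ \ S)).ncard = 2 * c * Nat.choose (c + q - 1) c) :
    ∃ X Y : Set V, Anticomplete G X Y ∧
      ¬ TreewidthLE (G.induce X) (c - 1) ∧ ¬ TreewidthLE (G.induce Y) (c - 1) := by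
  classical
  obtain ⟨f, hf, hzig⟩ := hz
  have hSf : S.toFinset.card = 2 * c + 3 * q := by rw [← Set.ncard_eq_toFinset_card', hS]
  obtain ⟨A, hAS, hA, hAlt, x, hx, hxmin⟩ := exists_initial_segment f S.toFinset
    (by simpa using hf) (k := c + q - 1) (by omega) (by omega)
  obtain ⟨B, hBS, hB, -, y, hy, hymax⟩ := exists_initial_segment (OrderDual.toDual ∘ f)
    (S.toFinset \ A) (fun u hu v hv h => hf (by simp at hu; exact hu.1) (by simp at hv; exact hv.1) h)
    (k := c + q - 1) (by omega) (by rw [Finset.card_sdiff_of_subset hAS]; omega)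
  have hAS' : ∀ z ∈ A, z ∈ S := fun z hz => Set.mem_toFinset.1 (hAS hz)
  have hBS' : ∀ z ∈ B, z ∈ S := fun z hz =>
    Set.mem_toFinset.1 (Finset.mem_sdiff.1 (hBS hz)).1
  have hAB : Disjoint A B :=
    Finset.disjoint_left.2 fun z hzA hzB => (Finset.mem_sdiff.1 (hBS hzB)).2 hzA
  have hlt : ∀ a ∈ A, ∀ b ∈ B, f a < f b := fun a ha b hb =>
    hAlt a ha b (Finset.mem_sdiff.1 (hBS hb)).1 (Finset.mem_sdiff.1 (hBS hb)).2
  obtain ⟨𝓛, h𝓛, h𝓛c⟩ : ∃ 𝓛 : Finset (Set V), (∀ L ∈ 𝓛, L ∈ CompsOn G (Set.univ \ S)) ∧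
      𝓛.card = 2 * c * (c + q - 1).choose c :=
    ⟨(Set.toFinite (CompsOn G (Set.univ \ S))).toFinset, by simp, by
      rw [← Set.ncard_eq_toFinset_card, hL]⟩
  obtain ⟨𝓛₁, h𝓛₁, h𝓛₁c⟩ := Finset.exists_subset_card_eq
    (show (c + q - 1).choose c * c ≤ 𝓛.card by rw [h𝓛c]; nlinarith)
  have h𝓛₂c : (c + q - 1).choose c * c ≤ (𝓛 \ 𝓛₁).card := by
    rw [Finset.card_sdiff_of_subset h𝓛₁, h𝓛c, h𝓛₁c]
    exact Nat.le_sub_of_add_le (by nlinarith)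
  obtain ⟨a, L₁, P, ha_inj, hL₁, haA, hL₁mem, hPL, hP, haP, hBP⟩ :=
    exists_bipartite_model hc ha A B hAS' hBS' hAB ⟨y, hy⟩ hq hA hx (by
      intro y' hy' p hp
      refine (Set.ncard_le_ncard ?_ (Set.toFinite _)).trans_lt
        (hzig x (hAS' x hx) y' (hBS' y' hy') (hlt x hx y' hy') p hp)
      exact fun z ⟨hzA, hzx, hz⟩ => ⟨hAS' z hzA, hxmin z hzA hzx, hlt z hzA y' hy', hz⟩)
      𝓛₁ (fun L hL => h𝓛 L (h𝓛₁ hL)) h𝓛₁c.ge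
  obtain ⟨b, L₂, Q, hb_inj, hL₂, hbB, hL₂mem, hQL, hQ, hbQ, hAQ⟩ :=
    exists_bipartite_model hc ha B A hBS' hAS' hAB.symm ⟨x, hx⟩ hq hB hy (by
      intro x' hx' p hp
      refine (Set.ncard_le_ncard ?_ (Set.toFinite _)).trans_lt
        (hzig x' (hAS' x' hx') y (hBS' y hy) (hlt x' hx' y hy) p.reverse hp.reverse)
      exact fun z ⟨hzB, hzy, hz⟩ => ⟨hBS' z hzB, hlt x' hx' z hzB, hymax z hzB hzy,
        by simpa using hz⟩)
      (𝓛 \ 𝓛₁) (fun L hL => h𝓛 L (Finset.mem_sdiff.1 hL).1) h𝓛₂c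
  have hC₁ : ∀ j, L₁ j ∈ CompsOn G (Set.univ \ S) := fun j => h𝓛 _ (h𝓛₁ (hL₁mem j))
  have hC₂ : ∀ j, L₂ j ∈ CompsOn G (Set.univ \ S) := fun j =>
    h𝓛 _ (Finset.mem_sdiff.1 (hL₂mem j)).1
  have hPS : ∀ j, ∀ v ∈ P j, v ∉ S := fun j v hv =>
    (subset_of_mem_compsOn (hC₁ j) (hPL j hv)).2
  have hQS : ∀ j, ∀ v ∈ Q j, v ∉ S := fun j v hv =>
    (subset_of_mem_compsOn (hC₂ j) (hQL j hv)).2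
  have hPQ : ∀ i j, ∀ u ∈ P i, ∀ v ∈ Q j, ¬ (u = v ∨ G.Adj u v) := fun i j u hu v hv h =>
    (Finset.mem_sdiff.1 (hL₂mem j)).2
      (eq_of_mem_compsOn (hC₁ i) (hC₂ j) (hPL i hu) (hQL j hv) h ▸ hL₁mem i)
  refine ⟨Set.range a ∪ ⋃ j, P j, Set.range b ∪ ⋃ j, Q j, ⟨?_, ?_⟩, ?_, ?_⟩
  · refine Set.disjoint_left.2 fun v hv hv' => ?_
    simp only [Set.mem_union, Set.mem_range, Set.mem_iUnion] at hv hv'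
    rcases hv with ⟨i, rfl⟩ | ⟨i, hi⟩ <;> rcases hv' with ⟨j, hj⟩ | ⟨j, hj⟩
    · exact Finset.disjoint_left.1 hAB (haA i) (hj ▸ hbB j)
    · exact hQS j _ hj (hAS' _ (haA i))
    · exact hPS i _ hi (hj ▸ hBS' _ (hbB j))
    · exact hPQ i j _ hi _ hj (Or.inl rfl)
  · intro u hu v hv huv
    simp only [Set.mem_union, Set.mem_range, Set.mem_iUnion] at hu hv
    rcases hu with ⟨i, rfl⟩ | ⟨i, hi⟩ <;> rcases hv with ⟨j, rfl⟩ | ⟨j, hj⟩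
    · exact hc.stable _ (hAS' _ (haA i)) _ (hBS' _ (hbB j)) huv
    · exact hAQ _ (haA i) j v hj huv
    · exact hBP _ (hbB j) i u hi huv.symm
    · exact hPQ i j u hi v hj (Or.inr huv)
  · exact not_treewidthLE_of_bipartite_minor hcpos _ a P ha_inj
      (fun i => Or.inl ⟨i, rfl⟩) (fun i => (Set.subset_iUnion P i).trans Set.subset_union_right)
      (fun i j h => hPS j _ h (hAS' _ (haA i))) hP
      (fun i j hij => Set.disjoint_left.2 fun v hi hj => hij (hL₁
        (eq_of_mem_compsOn (hC₁ i) (hC₁ j) (hPL i hi) (hPL j hj) (Or.inl rfl)))) haP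
  · exact not_treewidthLE_of_bipartite_minor hcpos _ b Q hb_inj
      (fun i => Or.inl ⟨i, rfl⟩) (fun i => (Set.subset_iUnion Q i).trans Set.subset_union_right)
      (fun i j h => hQS j _ h (hBS' _ (hbB i))) hQ
      (fun i j hij => Set.disjoint_left.2 fun v hi hj => hij (hL₂
        (eq_of_mem_compsOn (hC₂ i) (hC₂ j) (hQL i hi) (hQL j hj) (Or.inl rfl)))) hbQ
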